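/- Let p0, p1, p2 ∈ R_{2,1} have no common zeros on P^1 × P^1 and be non-generic. Then Syz(p) has five minimal generators: one of bidegree (6,1), three of bidegree (4,2), and one of bidegree (2,3). Precisely, there exist s ∈ Syz(p)_{6,1} and u ∈ Syz(p)_{2,3} such that s, the three Koszul syzygies (which lie in Syz(p)_{4,2}), and u generate Syz(p) as an R-module; moreover Syz(p) cannot be generated by fewer than five elements. -/

import Mathlib

open MvPolynomial

noncomputable section

/-- The bigraded polynomial ring `R = k[x,y,z,w]`; variables `0,1,2,3` are `x,y,z,w`. -/
abbrev Rk (k : Type*) [Field k] := MvPolynomial (Fin 4) k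

/-- The bigrading: `x, y` have degree `(1,0)`; `z, w` have degree `(0,1)`. -/
def bidegWt : Fin 4 → ℤ × ℤ := ![(1, 0), (1, 0), (0, 1), (0, 1)]

/-- `p` is bihomogeneous of bidegree `(m, n)` (with the convention that only the zero
polynomial is bihomogeneous of a bidegree with a negative coordinate). -/
def Bihom {k : Type*} [Field k] (p : Rk k) (m n : ℤ) : Prop :=
  p.IsWeightedHomogeneous bidegWt (m, n)

/-- `p0, p1, p2` have no common zeros on `ℙ¹ × ℙ¹`. -/
def NoCommonZeros {k : Type*} [Field k] (p0 p1 p2 : Rk k) : Prop :=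
  ∀ a b c d : k, (a, b) ≠ (0, 0) → (c, d) ≠ (0, 0) →
    eval ![a, b, c, d] p0 ≠ 0 ∨ eval ![a, b, c, d] p1 ≠ 0 ∨ eval ![a, b, c, d] p2 ≠ 0

/-- The map `(A0, A1, A2) ↦ A0 p0 + A1 p1 + A2 p2`, as a `k`-linear map on `R³`. -/
def syzMapk {k : Type*} [Field k] (p : Fin 3 → Rk k) : (Fin 3 → Rk k) →ₗ[k] Rk k :=
  ∑ i : Fin 3, (LinearMap.mulRight k (p i)).comp (LinearMap.proj i)

/-- The bigraded piece `Syz(p)_{m,n}`: triples `(A0, A1, A2)` of bihomogeneous polynomials of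
bidegree `(m-2, n-1)` with `A0 p0 + A1 p1 + A2 p2 = 0`, as a `k`-subspace of `R³`. -/
def SyzPiece {k : Type*} [Field k] (p : Fin 3 → Rk k) (m n : ℤ) :
    Submodule k (Fin 3 → Rk k) :=
  (Submodule.pi Set.univ fun _ => weightedHomogeneousSubmodule k bidegWt (m - 2, n - 1)) ⊓
    LinearMap.ker (syzMapk p)

/-- The syzygy module `Syz(p)`, as an `R`-submodule of `R³`. -/
def Syz {k : Type*} [Field k] (p : Fin 3 → Rk k) : Submodule (Rk k) (Fin 3 → Rk k) :=
  LinearMap.ker (∑ i : Fin 3, (LinearMap.mulRight (Rk k) (p i)).comp (LinearMap.proj i))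

/-- The Koszul submodule of `R³`: the `R`-submodule generated by the three Koszul syzygies
`(p1, −p0, 0)`, `(p2, 0, −p0)`, `(0, p2, −p1)`. -/
def KoszulSub {k : Type*} [Field k] (p0 p1 p2 : Rk k) : Submodule (Rk k) (Fin 3 → Rk k) :=
  Submodule.span (Rk k) {![p1, -p0, 0], ![p2, 0, -p0], ![0, p2, -p1]}

/-- `p0, p1, p2 ∈ R_{2,1}` are generic: only finitely many points `[a0 : a1 : a2]` of `ℙ²(k)`
are such that `a0 p0 + a1 p1 + a2 p2` factors as `q · l` with `q ∈ R_{2,0}`, `l ∈ R_{0,1}`. -/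
def BidegGeneric {k : Type*} [Field k] (p0 p1 p2 : Rk k) : Prop :=
  {P : Projectivization k (Fin 3 → k) |
    ∃ q l : Rk k, Bihom q 2 0 ∧ Bihom l 0 1 ∧
      P.rep 0 • p0 + P.rep 1 • p1 + P.rep 2 • p2 = q * l}.Finite


/-- The value at `(x, y)` of the binary quadratic form with coefficients `e`. -/
def quadVal {k : Type*} [Field k] (e : Fin 3 → k) (x y : k) : k :=
  e 0 * x ^ 2 + e 1 * x * y + e 2 * y ^ 2

theorem exists_quartic_zero {k : Type*} [Field k] [IsAlgClosed k] (e0 e1 e2 e3 e4 : k) :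
    ∃ x y : k, (x, y) ≠ (0, 0) ∧
      e0 * x ^ 4 + e1 * x ^ 3 * y + e2 * x ^ 2 * y ^ 2 + e3 * x * y ^ 3 + e4 * y ^ 4 = 0 := by
  by_cases h : e0 = 0
  · exact ⟨1, 0, by simp, by simp [h]⟩
  · set P : Polynomial k := Polynomial.C e0 * Polynomial.X ^ 4 + Polynomial.C e1 * Polynomial.X ^ 3
      + Polynomial.C e2 * Polynomial.X ^ 2 + Polynomial.C e3 * Polynomial.X + Polynomial.C e4
      with hP
    have hd : P.degree = 4 := by
      rw [hP]
      compute_degree!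
    obtain ⟨x, hx⟩ := IsAlgClosed.exists_root P (by rw [hd]; decide)
    refine ⟨x, 1, by simp, ?_⟩
    simp only [hP, Polynomial.IsRoot, Polynomial.eval_add, Polynomial.eval_mul,
      Polynomial.eval_C, Polynomial.eval_pow, Polynomial.eval_X] at hx
    simpa using hx

theorem exists_quadVal_zero {k : Type*} [Field k] [IsAlgClosed k] (e : Fin 3 → k) :
    ∃ x y : k, (x, y) ≠ (0, 0) ∧ quadVal e x y = 0 := by
  obtain ⟨x, y, hxy, h⟩ := exists_quartic_zero (e 0 ^ 2) (2 * e 0 * e 1)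
    (e 1 ^ 2 + 2 * e 0 * e 2) (2 * e 1 * e 2) (e 2 ^ 2)
  refine ⟨x, y, hxy, ?_⟩
  have : quadVal e x y ^ 2 = 0 := by
    rw [quadVal]
    linear_combination h
  exact pow_eq_zero_iff (two_ne_zero) |>.1 this

theorem exists_ker_of_det_eq_zero {k : Type*} [Field k] (f g f' g' : k)
    (h : f * g' - f' * g = 0) :
    ∃ c d : k, (c, d) ≠ (0, 0) ∧ c * f + d * g = 0 ∧ c * f' + d * g' = 0 := by
  by_cases h1 : f = 0 ∧ g = 0
  · obtain ⟨rfl, rfl⟩ := h1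
    by_cases h2 : f' = 0 ∧ g' = 0
    · obtain ⟨rfl, rfl⟩ := h2
      exact ⟨1, 0, by simp, by simp, by simp⟩
    · refine ⟨g', -f', ?_, by simp, by ring⟩
      simp only [ne_eq, Prod.mk.injEq, neg_eq_zero]
      tauto
  · refine ⟨g, -f, ?_, by ring, by linear_combination -h⟩
    simp only [ne_eq, Prod.mk.injEq, neg_eq_zero]
    tauto

/-- Any two forms of bidegree `(2,1)` have a common zero. -/
theorem exists_common_zero_pair {k : Type*} [Field k] [IsAlgClosed k] (F G F' G' : Fin 3 → k) :
    ∃ x y c d : k, (x, y) ≠ (0, 0) ∧ (c, d) ≠ (0, 0) ∧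
      c * quadVal F x y + d * quadVal G x y = 0 ∧
      c * quadVal F' x y + d * quadVal G' x y = 0 := by
  obtain ⟨x, y, hxy, h⟩ := exists_quartic_zero
    (F 0 * G' 0 - F' 0 * G 0)
    (F 0 * G' 1 + F 1 * G' 0 - (F' 0 * G 1 + F' 1 * G 0))
    (F 0 * G' 2 + F 1 * G' 1 + F 2 * G' 0 - (F' 0 * G 2 + F' 1 * G 1 + F' 2 * G 0))
    (F 1 * G' 2 + F 2 * G' 1 - (F' 1 * G 2 + F' 2 * G 1))
    (F 2 * G' 2 - F' 2 * G 2)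
  obtain ⟨c, d, hcd, h1, h2⟩ := exists_ker_of_det_eq_zero (quadVal F x y) (quadVal G x y)
    (quadVal F' x y) (quadVal G' x y) (by simp only [quadVal]; linear_combination h)
  exact ⟨x, y, c, d, hxy, hcd, h1, h2⟩

/-- The three forms `z F_i + w G_i` of bidegree `(2,1)` have no common zero. -/
def NoZero {k : Type*} [Field k] (F G : Fin 3 → Fin 3 → k) : Prop :=
  ∀ x y c d : k, (x, y) ≠ (0, 0) → (c, d) ≠ (0, 0) →
    ∃ i, c * quadVal (F i) x y + d * quadVal (G i) x y ≠ 0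

theorem NoZero.not_rank_one {k : Type*} [Field k] [IsAlgClosed k] {F G : Fin 3 → Fin 3 → k}
    (H : NoZero F G) {c d : k} (hcd : (c, d) ≠ (0, 0)) (n e : Fin 3 → k)
    (h : ∀ i j, c * F i j + d * G i j = n i * e j) : False := by
  obtain ⟨x, y, hxy, h0⟩ := exists_quadVal_zero e
  obtain ⟨i, hi⟩ := H x y c d hxy hcd
  apply hi
  simp only [quadVal] at h0 ⊢
  linear_combination n i * h0 + x ^ 2 * h i 0 + x * y * h i 1 + y ^ 2 * h i 2

theorem NoZero.independent {k : Type*} [Field k] [IsAlgClosed k] {F G : Fin 3 → Fin 3 → k}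
    (H : NoZero F G) {v : Fin 3 → k} (hF : ∀ j, ∑ i, v i * F i j = 0)
    (hG : ∀ j, ∑ i, v i * G i j = 0) : v = 0 := by
  simp only [Fin.sum_univ_three] at hF hG
  have key : ∀ x y c d : k, v 0 * (c * quadVal (F 0) x y + d * quadVal (G 0) x y)
      + v 1 * (c * quadVal (F 1) x y + d * quadVal (G 1) x y)
      + v 2 * (c * quadVal (F 2) x y + d * quadVal (G 2) x y) = 0 := by
    intro x y c d
    simp only [quadVal]
    linear_combination c * (x ^ 2 * hF 0 + x * y * hF 1 + y ^ 2 * hF 2)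
      + d * (x ^ 2 * hG 0 + x * y * hG 1 + y ^ 2 * hG 2)
  have pair : ∀ j l, ∃ x y c d : k, (x, y) ≠ (0, 0) ∧ (c, d) ≠ (0, 0) ∧
      c * quadVal (F j) x y + d * quadVal (G j) x y = 0 ∧
      c * quadVal (F l) x y + d * quadVal (G l) x y = 0 :=
    fun j l => exists_common_zero_pair _ _ _ _
  funext m
  by_contra hm
  fin_cases m
  · obtain ⟨x, y, c, d, hxy, hcd, h1, h2⟩ := pair 1 2
    have h := key x y c d
    obtain ⟨i, hi⟩ := H x y c d hxy hcd
    fin_cases i <;> simp_all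
  · obtain ⟨x, y, c, d, hxy, hcd, h1, h2⟩ := pair 0 2
    have h := key x y c d
    obtain ⟨i, hi⟩ := H x y c d hxy hcd
    fin_cases i <;> simp_all
  · obtain ⟨x, y, c, d, hxy, hcd, h1, h2⟩ := pair 0 1
    have h := key x y c d
    obtain ⟨i, hi⟩ := H x y c d hxy hcd
    fin_cases i <;> simp_all

theorem exists_smul_of_parallel {k ι : Type*} [Field k] {u v : ι → k} (hu : u ≠ 0)
    (h : ∀ i j, u i * v j = u j * v i) : ∃ c : k, ∀ i, v i = c * u i := by
  obtain ⟨i, hi⟩ := Function.ne_iff.1 hu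
  simp only [Pi.zero_apply] at hi
  refine ⟨v i / u i, fun j => ?_⟩
  field_simp
  linear_combination h i j

theorem parallel_of_cross_eq_zero {k : Type*} [Field k] {u v : Fin 3 → k}
    (h : crossProduct u v = 0) : ∀ i j, u i * v j = u j * v i := by
  rw [cross_apply] at h
  have h0 := congrFun h 0
  have h1 := congrFun h 1
  have h2 := congrFun h 2
  simp at h0 h1 h2
  intro i j
  fin_cases i <;> fin_cases j <;> simp <;> first
    | ring1
    | linear_combination h0
    | linear_combination h1
    | linear_combination h2
    | linear_combination -h0
    | linear_combination -h1
    | linear_combination -h2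

theorem exists_smul_cross {k : Type*} [Field k] {f g v : Fin 3 → k}
    (hn : crossProduct f g ≠ 0) (hf : ∑ i, v i * f i = 0) (hg : ∑ i, v i * g i = 0) :
    ∃ c : k, ∀ i, v i = c * crossProduct f g i := by
  apply exists_smul_of_parallel hn
  simp only [Fin.sum_univ_three] at hf hg
  intro i j
  rw [cross_apply]
  fin_cases i <;> fin_cases j <;> simp <;> first
    | ring1
    | linear_combination f 0 * hg - g 0 * hf
    | linear_combination f 1 * hg - g 1 * hf
    | linear_combination f 2 * hg - g 2 * hf
    | linear_combination -f 0 * hg + g 0 * hf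
    | linear_combination -f 1 * hg + g 1 * hf
    | linear_combination -f 2 * hg + g 2 * hf

theorem cubic_coeff_eq_zero {k : Type*} [Field k] [Infinite k] {c0 c1 c2 c3 : k}
    (h : ∀ t : k, c0 + c1 * t + c2 * t ^ 2 + c3 * t ^ 3 = 0) :
    c0 = 0 ∧ c1 = 0 ∧ c2 = 0 ∧ c3 = 0 := by
  have hP : (Polynomial.C c0 + Polynomial.C c1 * Polynomial.X
      + Polynomial.C c2 * Polynomial.X ^ 2 + Polynomial.C c3 * Polynomial.X ^ 3 : Polynomial k)
      = 0 := by
    apply Polynomial.funext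
    intro t
    simpa using h t
  have hc := fun n => congrArg (fun P => Polynomial.coeff P n) hP
  refine ⟨by simpa [Polynomial.coeff_X, Polynomial.coeff_X_pow, Polynomial.coeff_C] using hc 0,
    by simpa [Polynomial.coeff_X, Polynomial.coeff_X_pow, Polynomial.coeff_C] using hc 1,
    by simpa [Polynomial.coeff_X, Polynomial.coeff_X_pow, Polynomial.coeff_C] using hc 2,
    by simpa [Polynomial.coeff_X, Polynomial.coeff_X_pow, Polynomial.coeff_C] using hc 3⟩

/-- A singular pencil of `3 × 3` matrices with columns `A + t A'`, `B + t B'`, `D + t D'` has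
the kernel vector `(A + t A') × (B + t B')`, of degree two in `t`. -/
theorem pencil_kernel {k : Type*} [Field k] [Infinite k] (A B D A' B' D' : Fin 3 → k)
    (hdet : ∀ t : k, ∑ i, crossProduct (A + t • A') (B + t • B') i * (D + t • D') i = 0) :
    ∃ β γ : Fin 3 → k, ∀ Y Y' : Fin 3 → k, (Y = A ∧ Y' = A' ∨ Y = B ∧ Y' = B' ∨ Y = D ∧ Y' = D') →
      ∑ i, crossProduct A B i * Y i = 0 ∧
      ∑ i, crossProduct A B i * Y' i + ∑ i, β i * Y i = 0 ∧
      ∑ i, β i * Y' i + ∑ i, γ i * Y i = 0 ∧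
      ∑ i, γ i * Y' i = 0 := by
  refine ⟨crossProduct A B' + crossProduct A' B, crossProduct A' B', ?_⟩
  rintro Y Y' (⟨rfl, rfl⟩ | ⟨rfl, rfl⟩ | ⟨rfl, rfl⟩)
  · simp [cross_apply, Fin.sum_univ_three]
    refine ⟨?_, ?_, ?_, ?_⟩ <;> ring
  · simp [cross_apply, Fin.sum_univ_three]
    refine ⟨?_, ?_, ?_, ?_⟩ <;> ring
  · apply cubic_coeff_eq_zero
    intro t
    rw [← hdet t]
    simp [cross_apply, Fin.sum_univ_three]
    ring

/-- Kronecker normal form of a triple of `(2,1)`-forms without common zeros whose coefficient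
pencil is singular. -/
theorem NoZero.exists_normal_form {k : Type*} [Field k] [IsAlgClosed k]
    {F G : Fin 3 → Fin 3 → k} (H : NoZero F G)
    (hdet : ∀ t : k, ∑ i, crossProduct ((fun i => F i 0) + t • (fun i => G i 0))
      ((fun i => F i 1) + t • (fun i => G i 1)) i
        * ((fun i => F i 2) + t • (fun i => G i 2)) i = 0) :
    ∃ (Λ : Matrix (Fin 3) (Fin 3) k) (a b : Fin 3 → k), Λ.det ≠ 0 ∧
      (∀ x y : k, (x, y) ≠ (0, 0) → quadVal a x y ≠ 0 ∨ quadVal b x y ≠ 0) ∧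
      (∀ j, ∑ i, Λ 0 i * F i j = a j) ∧ (∀ j, ∑ i, Λ 0 i * G i j = 0) ∧
      (∀ j, ∑ i, Λ 1 i * F i j = b j) ∧ (∀ j, ∑ i, Λ 1 i * G i j = a j) ∧
      (∀ j, ∑ i, Λ 2 i * F i j = 0) ∧ (∀ j, ∑ i, Λ 2 i * G i j = b j) := by
  obtain ⟨α, β, γ, hα, h1, h2, h3, h4⟩ : ∃ α β γ : Fin 3 → k, α ≠ 0 ∧
      (∀ j, ∑ i, α i * F i j = 0) ∧
      (∀ j, ∑ i, α i * G i j + ∑ i, β i * F i j = 0) ∧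
      (∀ j, ∑ i, β i * G i j + ∑ i, γ i * F i j = 0) ∧
      (∀ j, ∑ i, γ i * G i j = 0) := by
    by_cases c01 : crossProduct (fun i => F i 0) (fun i => F i 1) = 0
    · by_cases c02 : crossProduct (fun i => F i 0) (fun i => F i 2) = 0
      · by_cases c12 : crossProduct (fun i => F i 1) (fun i => F i 2) = 0
        · exfalso
          have p01 := parallel_of_cross_eq_zero c01
          have p02 := parallel_of_cross_eq_zero c02
          have p12 := parallel_of_cross_eq_zero c12
          by_cases z0 : (fun i => F i 0) = 0
          · by_cases z1 : (fun i => F i 1) = 0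
            · refine H.not_rank_one (c := 1) (d := 0) (by simp) (fun i => F i 2) ![0, 0, 1] ?_
              intro i j
              have e0 := congrFun z0 i
              have e1 := congrFun z1 i
              fin_cases j <;> simp_all
            · obtain ⟨c, hc⟩ := exists_smul_of_parallel z1 p12
              refine H.not_rank_one (c := 1) (d := 0) (by simp) (fun i => F i 1) ![0, 1, c] ?_
              intro i j
              have e0 := congrFun z0 i
              have e1 := hc i
              fin_cases j <;> simp_all [mul_comm]
          · obtain ⟨c, hc⟩ := exists_smul_of_parallel z0 p01
            obtain ⟨c', hc'⟩ := exists_smul_of_parallel z0 p02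
            refine H.not_rank_one (c := 1) (d := 0) (by simp) (fun i => F i 0) ![1, c, c'] ?_
            intro i j
            have e0 := hc i
            have e1 := hc' i
            fin_cases j <;> simp_all [mul_comm]
        · obtain ⟨β, γ, h⟩ := pencil_kernel (fun i => F i 1) (fun i => F i 2) (fun i => F i 0)
            (fun i => G i 1) (fun i => G i 2) (fun i => G i 0) (by
              intro t
              rw [← hdet t]
              simp [cross_apply, Fin.sum_univ_three]
              ring)
          have hh : ∀ j, _ := fun j => h (fun i => F i j) (fun i => G i j)
            (by fin_cases j <;> simp)
          exact ⟨_, β, γ, c12, fun j => (hh j).1, fun j => (hh j).2.1, fun j => (hh j).2.2.1,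
            fun j => (hh j).2.2.2⟩
      · obtain ⟨β, γ, h⟩ := pencil_kernel (fun i => F i 0) (fun i => F i 2) (fun i => F i 1)
          (fun i => G i 0) (fun i => G i 2) (fun i => G i 1) (by
            intro t
            rw [← neg_eq_zero, ← hdet t]
            simp [cross_apply, Fin.sum_univ_three]
            ring)
        have hh : ∀ j, _ := fun j => h (fun i => F i j) (fun i => G i j)
          (by fin_cases j <;> simp)
        exact ⟨_, β, γ, c02, fun j => (hh j).1, fun j => (hh j).2.1, fun j => (hh j).2.2.1,
          fun j => (hh j).2.2.2⟩
    · obtain ⟨β, γ, h⟩ := pencil_kernel (fun i => F i 0) (fun i => F i 1) (fun i => F i 2)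
        (fun i => G i 0) (fun i => G i 1) (fun i => G i 2) hdet
      have hh : ∀ j, _ := fun j => h (fun i => F i j) (fun i => G i j)
        (by fin_cases j <;> simp)
      exact ⟨_, β, γ, c01, fun j => (hh j).1, fun j => (hh j).2.1, fun j => (hh j).2.2.1,
        fun j => (hh j).2.2.2⟩
  obtain ⟨a, ha⟩ : ∃ a : Fin 3 → k, ∀ j, a j = ∑ i, γ i * F i j := ⟨_, fun _ => rfl⟩
  obtain ⟨b, hb⟩ : ∃ b : Fin 3 → k, ∀ j, b j = ∑ i, α i * G i j := ⟨_, fun _ => rfl⟩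
  have hβF : ∀ j, ∑ i, β i * F i j = - b j := fun j => by rw [hb]; linear_combination h2 j
  have hβG : ∀ j, ∑ i, β i * G i j = - a j := fun j => by rw [ha]; linear_combination h3 j
  have hab : ∀ x y : k, (x, y) ≠ (0, 0) → quadVal a x y ≠ 0 ∨ quadVal b x y ≠ 0 := by
    intro x y hxy
    by_contra! hcon
    obtain ⟨hax, hbx⟩ := hcon
    set f : Fin 3 → k := fun i => quadVal (F i) x y with hf
    set g : Fin 3 → k := fun i => quadVal (G i) x y with hg
    have hn : crossProduct f g ≠ 0 := by
      intro hn
      have hp := parallel_of_cross_eq_zero hn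
      by_cases hf0 : f = 0
      · obtain ⟨i, hi⟩ := H x y 1 0 hxy (by simp)
        apply hi
        have := congrFun hf0 i
        simp [hf] at this
        simp [this]
      · obtain ⟨c, hc⟩ := exists_smul_of_parallel hf0 hp
        obtain ⟨i, hi⟩ := H x y (-c) 1 hxy (by simp)
        apply hi
        have := hc i
        simp only [hf, hg] at this
        rw [this]; ring
    have lin : ∀ (v e : Fin 3 → k) (K : Fin 3 → Fin 3 → k), (∀ j, ∑ i, v i * K i j = e j) →
        ∑ i, v i * quadVal (K i) x y = quadVal e x y := by
      intro v e K h
      simp only [Fin.sum_univ_three] at h ⊢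
      simp only [quadVal, ← h]
      ring
    have z0 : quadVal (0 : Fin 3 → k) x y = 0 := by simp [quadVal]
    have za : quadVal (fun j => -a j) x y = 0 := by
      simp only [quadVal] at hax ⊢; linear_combination -hax
    have zb : quadVal (fun j => -b j) x y = 0 := by
      simp only [quadVal] at hbx ⊢; linear_combination -hbx
    obtain ⟨cα, eα⟩ := exists_smul_cross (v := α) hn
      ((lin α 0 F h1).trans z0) ((lin α b G fun j => (hb j).symm).trans hbx)
    obtain ⟨cβ, eβ⟩ := exists_smul_cross (v := β) hn
      ((lin β _ F hβF).trans zb) ((lin β _ G hβG).trans za)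
    have hcα : cα ≠ 0 := by
      rintro rfl
      apply hα
      funext i
      simp [eα i]
    have hβα : ∀ i, β i = cβ / cα * α i := by
      intro i
      rw [eβ, eα]
      field_simp
    apply hα
    apply H.independent h1
    intro j
    have e1 := h2 j
    have e2 := h1 j
    simp only [Fin.sum_univ_three, hβα] at e1 e2 ⊢
    linear_combination e1 - cβ / cα * e2
  refine ⟨![γ, -β, α], a, b, ?_, hab, fun j => (ha j).symm, h4, ?_, ?_, h1,
    fun j => (hb j).symm⟩
  · intro hd
    obtain ⟨v, hv, hv0⟩ := Matrix.exists_vecMul_eq_zero_iff.2 hd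
    have e : ∀ i, v 0 * γ i - v 1 * β i + v 2 * α i = 0 := by
      intro i
      have := congrFun hv0 i
      simp [Matrix.vecMul, dotProduct, Fin.sum_univ_three] at this
      linear_combination this
    have eF : ∀ j, v 0 * a j + v 1 * b j = 0 := by
      intro j
      have t1 := ha j
      have t2 := hβF j
      have t3 := h1 j
      simp only [Fin.sum_univ_three] at t1 t2 t3
      linear_combination F 0 j * e 0 + F 1 j * e 1 + F 2 j * e 2 + v 0 * t1 + v 1 * t2
        - v 2 * t3
    have eG : ∀ j, v 1 * a j + v 2 * b j = 0 := by
      intro j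
      have t1 := hb j
      have t2 := hβG j
      have t3 := h4 j
      simp only [Fin.sum_univ_three] at t1 t2 t3
      linear_combination G 0 j * e 0 + G 1 j * e 1 + G 2 j * e 2 + v 2 * t1 + v 1 * t2
        - v 0 * t3
    have indep : ∀ c d : k, (∀ j, c * a j + d * b j = 0) → c = 0 ∧ d = 0 := by
      intro c d hcd
      have hq : ∀ x y, c * quadVal a x y + d * quadVal b x y = 0 := by
        intro x y
        simp only [quadVal]
        linear_combination x ^ 2 * hcd 0 + x * y * hcd 1 + y ^ 2 * hcd 2
      constructor
      · by_contra hc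
        obtain ⟨x, y, hxy, h0⟩ := exists_quadVal_zero b
        have := hq x y
        have := hab x y hxy
        simp_all
      · by_contra hc
        obtain ⟨x, y, hxy, h0⟩ := exists_quadVal_zero a
        have := hq x y
        have := hab x y hxy
        simp_all
    apply hv
    have r1 := indep _ _ eF
    have r2 := indep _ _ eG
    funext i
    fin_cases i
    · exact r1.1
    · exact r1.2
    · exact r2.2
  · intro j
    have := hβF j
    simp [Fin.sum_univ_three] at this ⊢
    linear_combination -this
  · intro j
    have := hβG j
    simp [Fin.sum_univ_three] at this ⊢
    linear_combination -this

/-- The binary quadratic form in `x, y` with coefficients `e`. -/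
def binForm {k : Type*} [Field k] (e : Fin 3 → k) : Rk k :=
  C (e 0) * X 0 ^ 2 + C (e 1) * (X 0 * X 1) + C (e 2) * X 1 ^ 2

theorem eval_binForm {k : Type*} [Field k] (e : Fin 3 → k) (v : Fin 4 → k) :
    eval v (binForm e) = quadVal e (v 0) (v 1) := by
  simp [binForm, quadVal]
  ring

theorem weight_bidegWt (d : Fin 4 →₀ ℕ) :
    Finsupp.weight bidegWt d = ((d 0 + d 1 : ℤ), (d 2 + d 3 : ℤ)) := by
  rw [Finsupp.weight_apply, Finsupp.sum_fintype _ _ (by simp), Fin.sum_univ_four]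
  simp [bidegWt]

theorem monomial_fin_four {k : Type*} [Field k] (d : Fin 4 →₀ ℕ) (c : k) :
    (monomial d c : Rk k) = C c * (X 0 ^ d 0 * X 1 ^ d 1 * X 2 ^ d 2 * X 3 ^ d 3) := by
  rw [monomial_eq, Finsupp.prod_fintype _ _ (by simp), Fin.prod_univ_four]

theorem Bihom.eq_two_one {k : Type*} [Field k] {p : Rk k} (h : Bihom p 2 1) :
    ∃ F G : Fin 3 → k, p = X 2 * binForm F + X 3 * binForm G := by
  rw [← p.support_sum_monomial_coeff]
  apply Finset.sum_induction _ (fun q : Rk k => ∃ F G : Fin 3 → k,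
    q = X 2 * binForm F + X 3 * binForm G)
  · rintro _ _ ⟨F, G, rfl⟩ ⟨F', G', rfl⟩
    refine ⟨F + F', G + G', ?_⟩
    simp [binForm]
    ring
  · exact ⟨0, 0, by simp [binForm]⟩
  · intro d hd
    have hw := h (mem_support_iff.1 hd)
    rw [weight_bidegWt, Prod.mk.injEq] at hw
    obtain ⟨hw1, hw2⟩ := hw
    have e1 : d 0 = 2 ∧ d 1 = 0 ∨ d 0 = 1 ∧ d 1 = 1 ∨ d 0 = 0 ∧ d 1 = 2 := by omega
    have e2 : d 2 = 1 ∧ d 3 = 0 ∨ d 2 = 0 ∧ d 3 = 1 := by omega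
    rw [monomial_fin_four]
    generalize coeff d p = c
    rcases e2 with ⟨h2, h3⟩ | ⟨h2, h3⟩ <;>
      rcases e1 with ⟨h0, h1⟩ | ⟨h0, h1⟩ | ⟨h0, h1⟩ <;> rw [h0, h1, h2, h3]
    · exact ⟨![c, 0, 0], 0, by simp [binForm]; ring⟩
    · exact ⟨![0, c, 0], 0, by simp [binForm]; ring⟩
    · exact ⟨![0, 0, c], 0, by simp [binForm]; ring⟩
    · exact ⟨0, ![c, 0, 0], by simp [binForm]; ring⟩
    · exact ⟨0, ![0, c, 0], by simp [binForm]; ring⟩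
    · exact ⟨0, ![0, 0, c], by simp [binForm]; ring⟩

theorem Bihom.exists_zero_of_zero_one {k : Type*} [Field k] {l : Rk k} (h : Bihom l 0 1) :
    ∃ c d : k, (c, d) ≠ (0, 0) ∧ ∀ x y : k, eval ![x, y, c, d] l = 0 := by
  obtain ⟨s, t, rfl⟩ : ∃ s t : k, l = C s * X 2 + C t * X 3 := by
    rw [← l.support_sum_monomial_coeff]
    apply Finset.sum_induction _ (fun q : Rk k => ∃ s t : k, q = C s * X 2 + C t * X 3)
    · rintro _ _ ⟨F, G, rfl⟩ ⟨F', G', rfl⟩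
      exact ⟨F + F', G + G', by simp; ring⟩
    · exact ⟨0, 0, by simp⟩
    · intro d hd
      have hw := h (mem_support_iff.1 hd)
      rw [weight_bidegWt, Prod.mk.injEq] at hw
      obtain ⟨hw1, hw2⟩ := hw
      have e1 : d 0 = 0 ∧ d 1 = 0 := by omega
      have e2 : d 2 = 1 ∧ d 3 = 0 ∨ d 2 = 0 ∧ d 3 = 1 := by omega
      rw [monomial_fin_four]
      rcases e2 with ⟨h2, h3⟩ | ⟨h2, h3⟩ <;> rw [e1.1, e1.2, h2, h3]
      · exact ⟨coeff d l, 0, by simp⟩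
      · exact ⟨0, coeff d l, by simp⟩
  by_cases hst : s = 0 ∧ t = 0
  · exact ⟨1, 0, by simp, by simp [hst.1, hst.2]⟩
  · refine ⟨t, -s, ?_, ?_⟩
    · simp only [ne_eq, Prod.mk.injEq, neg_eq_zero]
      tauto
    · intro x y
      simp
      ring

theorem isRelPrime_binForm {k : Type*} [Field k] [IsAlgClosed k] {a b : Fin 3 → k}
    (hab : ∀ x y : k, (x, y) ≠ (0, 0) → quadVal a x y ≠ 0 ∨ quadVal b x y ≠ 0) :
    IsRelPrime (binForm a) (binForm b) := by
  have hrad : ∀ i : Fin 4, (∀ v : Fin 4 → k, v 0 = 0 → v 1 = 0 → v i = 0) →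
      (X i : Rk k) ∈ (Ideal.span {binForm a, binForm b}).radical := by
    intro i hi
    rw [← vanishingIdeal_zeroLocus_eq_radical (K := k), mem_vanishingIdeal_iff]
    intro v hv
    rw [mem_zeroLocus_iff] at hv
    have e1 := hv _ (Ideal.subset_span (Set.mem_insert _ _))
    have e2 := hv _ (Ideal.subset_span (Set.mem_insert_of_mem _ rfl))
    simp only [aeval_eq_eval, eval_binForm] at e1 e2
    have h0 : (v 0, v 1) = (0, 0) := by
      by_contra h
      have := hab _ _ h
      tauto
    rw [Prod.mk.injEq] at h0
    simpa using hi v h0.1 h0.2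
  obtain ⟨m, hm⟩ := hrad 0 fun _ h _ => h
  obtain ⟨n, hn⟩ := hrad 1 fun _ _ h => h
  intro d hda hdb
  have hle : Ideal.span {binForm a, binForm b} ≤ Ideal.span {d} := by
    rw [Ideal.span_le]
    rintro _ (rfl | rfl)
    · exact Ideal.mem_span_singleton.2 hda
    · exact Ideal.mem_span_singleton.2 hdb
  have h0 : d ∣ X 0 ^ m := Ideal.mem_span_singleton.1 (hle hm)
  have h1 : d ∣ X 1 ^ n := Ideal.mem_span_singleton.1 (hle hn)
  have hrel : IsRelPrime (X 0 ^ m : Rk k) (X 1 ^ n) := by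
    apply IsRelPrime.pow
    apply (Irreducible.isRelPrime_iff_not_dvd (X_prime (i := (0 : Fin 4))).irreducible).2
    simp [X_dvd_X]
  exact hrel h0 h1

/-- Substitution of zero for the variable `X i`. -/
def killVar {k : Type*} [Field k] (i : Fin 4) : Rk k →ₐ[k] Rk k :=
  aeval (Function.update X i 0)

theorem exists_eq_killVar_add {k : Type*} [Field k] (i : Fin 4) (P : Rk k) :
    ∃ Q, P = killVar i P + X i * Q := by
  induction P using MvPolynomial.induction_on with
  | C a => exact ⟨0, by simp [killVar]⟩
  | add p q hp hq =>
    obtain ⟨p', hp⟩ := hp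
    obtain ⟨q', hq⟩ := hq
    exact ⟨p' + q', by rw [map_add]; linear_combination hp + hq⟩
  | mul_X p j hp =>
    obtain ⟨p', hp⟩ := hp
    by_cases hij : j = i
    · subst hij
      exact ⟨p, by simp [killVar, mul_comm]⟩
    · refine ⟨p' * X j, ?_⟩
      have : killVar i (X j : Rk k) = X j := by simp [killVar, hij]
      rw [map_mul, this]
      linear_combination X j * hp

theorem killVar_X_self {k : Type*} [Field k] (i : Fin 4) : killVar i (X i : Rk k) = 0 := by
  simp [killVar]

theorem killVar_binForm {k : Type*} [Field k] (e : Fin 3 → k) {i : Fin 4} (h0 : i ≠ 0)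
    (h1 : i ≠ 1) : killVar i (binForm e) = binForm e := by
  simp [killVar, binForm, h0.symm, h1.symm]

theorem syzygy_of_isRelPrime {k : Type*} [Field k] {a b P Q : Rk k} (ha : a ≠ 0)
    (hab : IsRelPrime a b) (h : a * P + b * Q = 0) : ∃ E, P = b * E ∧ Q = -(a * E) := by
  have hd : a ∣ b * Q := ⟨-P, by linear_combination h⟩
  obtain ⟨E, rfl⟩ := hab.dvd_of_dvd_mul_left hd
  refine ⟨-E, ?_, by ring⟩
  apply mul_left_cancel₀ ha
  linear_combination h

/-- `X i` is a nonzerodivisor modulo two forms not involving it. -/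
theorem mem_of_X_mul_mem {k : Type*} [Field k] {a b D P Q : Rk k} {i : Fin 4}
    (hai : killVar i a = a) (hbi : killVar i b = b)
    (h : X i * D = a * P + b * Q) : ∃ P' Q', D = a * P' + b * Q' := by
  have h' := congrArg (killVar i) h
  simp only [map_mul, map_add, hai, hbi, killVar_X_self, zero_mul] at h'
  obtain ⟨P', hP⟩ := exists_eq_killVar_add i P
  obtain ⟨Q', hQ⟩ := exists_eq_killVar_add i Q
  refine ⟨P', Q', mul_left_cancel₀ (X_ne_zero i) ?_⟩
  linear_combination h - h' + a * hP + b * hQ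

/-- `z, w` is a regular sequence modulo two coprime forms in `x, y`. -/
theorem exists_of_mul_add_mul_mem {k : Type*} [Field k] {a b D D' P Q : Rk k} 
    (hai : ∀ i : Fin 4, i ≠ 0 → i ≠ 1 → killVar i a = a)
    (hbi : ∀ i : Fin 4, i ≠ 0 → i ≠ 1 → killVar i b = b)
    (h : X 2 * D + X 3 * D' = a * P + b * Q) :
    ∃ G P₁ Q₁ P₂ Q₂, D = X 3 * G + a * P₁ + b * Q₁ ∧ D' = -(X 2 * G) + a * P₂ + b * Q₂ := by
  have h' := congrArg (killVar 2) h
  have hX : killVar 2 (X 3 : Rk k) = X 3 := by simp [killVar]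
  simp only [map_mul, map_add, hai 2 (by decide) (by decide), hbi 2 (by decide) (by decide),
    killVar_X_self, zero_mul, zero_add, hX] at h'
  obtain ⟨P₂, Q₂, h2⟩ := mem_of_X_mul_mem (hai 3 (by decide) (by decide))
    (hbi 3 (by decide) (by decide)) h'
  obtain ⟨G, hG⟩ := exists_eq_killVar_add 2 D'
  obtain ⟨P₁, Q₁, h1⟩ := mem_of_X_mul_mem (D := D + X 3 * G) (P := P - X 3 * P₂)
    (Q := Q - X 3 * Q₂) (hai 2 (by decide) (by decide)) (hbi 2 (by decide) (by decide)) (by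
      linear_combination h - X 3 * hG - X 3 * h2)
  exact ⟨-G, P₁, Q₁, P₂, Q₂, by linear_combination h1, by linear_combination hG + h2⟩

/-- Generators of the syzygies of `z a, z b + w a, w b`, for coprime forms `a, b` in `x, y`. -/
theorem normal_form_syzygy {k : Type*} [Field k] {a b A B D : Rk k} (ha : a ≠ 0)
    (hab : IsRelPrime a b) (hai : ∀ i : Fin 4, i ≠ 0 → i ≠ 1 → killVar i a = a)
    (hbi : ∀ i : Fin 4, i ≠ 0 → i ≠ 1 → killVar i b = b)
    (h : A * (X 2 * a) + B * (X 2 * b + X 3 * a) + D * (X 3 * b) = 0) :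
    ∃ r₁ r₂ r₃ r₄ r₅ : Rk k,
      A = r₁ * b ^ 2 + r₂ * (X 2 * b + X 3 * a) + r₃ * (X 3 * b) + r₅ * X 3 ^ 2 ∧
      B = -(r₁ * (a * b)) - r₂ * (X 2 * a) + r₄ * (X 3 * b) - r₅ * (X 2 * X 3) ∧
      D = r₁ * a ^ 2 - r₃ * (X 2 * a) - r₄ * (X 2 * b + X 3 * a) + r₅ * X 2 ^ 2 := by
  have hX : (X 2 : Rk k) ≠ 0 := X_ne_zero _
  have hzw : IsRelPrime (X 2 : Rk k) (X 3) := by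
    apply (Irreducible.isRelPrime_iff_not_dvd (X_prime (i := (2 : Fin 4))).irreducible).2
    simp [X_dvd_X]
  obtain ⟨E, h1, h2⟩ := syzygy_of_isRelPrime (P := A * a + B * b) (Q := B * a + D * b) hX hzw
    (by linear_combination h)
  obtain ⟨E₁, E₂, hE⟩ := mem_of_X_mul_mem (D := E) (P := A) (Q := B) (hai 3 (by decide) (by decide)) (hbi 3 (by decide) (by decide)) (by linear_combination -h1)
  obtain ⟨U, hU1, hU2⟩ := syzygy_of_isRelPrime (P := A - X 3 * E₁) (Q := B - X 3 * E₂) ha hab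
    (by linear_combination h1 + X 3 * hE)
  obtain ⟨V, hV1, hV2⟩ := syzygy_of_isRelPrime (P := B + X 2 * E₁) (Q := D + X 2 * E₂) ha hab
    (by linear_combination h2 - X 2 * hE)
  obtain ⟨G, P₁, Q₁, P₂, Q₂, hD1, hD2⟩ := exists_of_mul_add_mul_mem (D := E₁) (D' := E₂)
    (P := U) (Q := V) hai hbi (by linear_combination hV1 - hU2)
  obtain ⟨W, hW1, hW2⟩ := syzygy_of_isRelPrime
    (P := A - (P₁ * (X 2 * b + X 3 * a) + (Q₁ + P₂) * (X 3 * b) + G * X 3 ^ 2))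
    (Q := B - (- P₁ * (X 2 * a) + Q₂ * (X 3 * b) - G * (X 2 * X 3))) ha hab
    (by rw [hD1, hD2] at hE; linear_combination h1 + X 3 * hE)
  obtain ⟨W', hW1', hW2'⟩ := syzygy_of_isRelPrime
    (P := B - (- P₁ * (X 2 * a) + Q₂ * (X 3 * b) - G * (X 2 * X 3)))
    (Q := D - (- (Q₁ + P₂) * (X 2 * a) - Q₂ * (X 2 * b + X 3 * a) + G * X 2 ^ 2)) ha hab
    (by rw [hD1, hD2] at hE; linear_combination h2 - X 2 * hE)
  obtain ⟨Y, hY1, hY2⟩ := syzygy_of_isRelPrime (P := W) (Q := W') ha hab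
    (by linear_combination hW2 - hW1')
  refine ⟨Y, P₁, Q₁ + P₂, Q₂, G, ?_, ?_, ?_⟩
  · rw [hY1] at hW1
    linear_combination hW1
  · rw [hY1] at hW2
    linear_combination hW2
  · rw [hY2] at hW2'
    linear_combination hW2'

theorem quad_coeff_eq_zero {k : Type*} [Field k] {e : Fin 3 → k}
    (h : ∀ x y : k, quadVal e x y = 0) : ∀ j, e j = 0 := by
  have h0 := h 1 0
  have h2 := h 0 1
  have h1 := h 1 1
  simp only [quadVal] at h0 h1 h2
  intro j
  fin_cases j
  · simpa using h0
  · simp only [Fin.mk_one]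
    linear_combination h1 - h0 - h2
  · simpa using h2

theorem binForm_ne_zero_of_eval {k : Type*} [Field k] {e : Fin 3 → k} {x y : k}
    (h : quadVal e x y ≠ 0) : binForm e ≠ 0 := by
  intro h0
  apply h
  have := eval_binForm e ![x, y, 0, 0]
  simpa [h0] using this.symm

theorem NoZero.subsingleton_kernel {k : Type*} [Field k] [IsAlgClosed k]
    {F G : Fin 3 → Fin 3 → k} (H : NoZero F G) {c d : k} (hcd : (c, d) ≠ (0, 0)) :
    {P : Projectivization k (Fin 3 → k) |
      ∀ j, ∑ i, (c * F i j + d * G i j) * P.rep i = 0}.Subsingleton := by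
  intro P hP Q hQ
  have hn : crossProduct P.rep Q.rep = 0 := by
    by_contra hn
    have hc : ∀ j, ∃ e : k, ∀ i, c * F i j + d * G i j = e * crossProduct P.rep Q.rep i :=
      fun j => exists_smul_cross hn (hP j) (hQ j)
    choose e he using hc
    exact H.not_rank_one hcd (crossProduct P.rep Q.rep) e fun i j => by rw [he j i, mul_comm]
  obtain ⟨a, ha⟩ := exists_smul_of_parallel P.rep_nonzero (parallel_of_cross_eq_zero hn)
  rw [← P.mk_rep, ← Q.mk_rep]
  symm
  rw [Projectivization.mk_eq_mk_iff']
  exact ⟨a, funext fun i => (ha i).symm⟩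

/-- For a non-generic triple, the coefficient pencil is singular. -/
theorem NoZero.singular_pencil {k : Type*} [Field k] [IsAlgClosed k] {F G : Fin 3 → Fin 3 → k}
    (H : NoZero F G)
    (hgen : ¬ BidegGeneric (X 2 * binForm (F 0) + X 3 * binForm (G 0))
      (X 2 * binForm (F 1) + X 3 * binForm (G 1)) (X 2 * binForm (F 2) + X 3 * binForm (G 2)))
    (t : k) : Matrix.det (Matrix.of fun i j => F i j + t * G i j) = 0 := by
  by_contra ht
  apply hgen
  set Q : Polynomial k := Matrix.det (Matrix.of fun i j =>
    Polynomial.C (F i j) + Polynomial.X * Polynomial.C (G i j)) with hQ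
  have hQe : ∀ t, Q.eval t = Matrix.det (Matrix.of fun i j => F i j + t * G i j) := by
    intro t
    rw [hQ, Matrix.det_fin_three, Matrix.det_fin_three]
    simp
    ring
  have hQ0 : Q ≠ 0 := by
    intro h
    apply ht
    rw [← hQe, h, Polynomial.eval_zero]
  have hfin : {t | Q.IsRoot t}.Finite := Polynomial.finite_setOfPred_isRoot hQ0
  refine Set.Finite.subset (Set.Finite.union
    (H.subsingleton_kernel (c := 0) (d := 1) (by simp)).finite
    (hfin.biUnion fun t _ => (H.subsingleton_kernel (c := 1) (d := t) (by simp)).finite)) ?_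
  rintro P ⟨q, l, -, hl, hP⟩
  obtain ⟨c, d, hcd, h0⟩ := hl.exists_zero_of_zero_one
  have hker : ∀ j, P.rep 0 * (c * F 0 j + d * G 0 j) + P.rep 1 * (c * F 1 j + d * G 1 j)
      + P.rep 2 * (c * F 2 j + d * G 2 j) = 0 := by
    apply quad_coeff_eq_zero
    intro x y
    have h := congrArg (eval ![x, y, c, d]) hP
    rw [map_mul, h0, mul_zero] at h
    simp only [map_add, smul_eval, map_mul, eval_X, eval_binForm] at h
    simp [quadVal] at h ⊢
    linear_combination h
  by_cases hc : c = 0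
  · left
    have hd : d ≠ 0 := by
      rintro rfl
      exact hcd (by rw [hc])
    intro j
    apply mul_left_cancel₀ hd
    have := hker j
    rw [hc] at this
    rw [Fin.sum_univ_three]
    linear_combination this
  · right
    have hker' : ∀ j, ∑ i, (1 * F i j + d / c * G i j) * P.rep i = 0 := by
      intro j
      apply mul_left_cancel₀ hc
      have := hker j
      rw [Fin.sum_univ_three]
      field_simp
      linear_combination this
    refine Set.mem_biUnion (x := d / c) ?_ hker'
    change Q.eval _ = 0
    rw [hQe]
    apply Matrix.exists_vecMul_eq_zero_iff.1
    refine ⟨P.rep, P.rep_nonzero, funext fun j => ?_⟩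
    rw [Pi.zero_apply, ← hker' j]
    simp [Matrix.vecMul, dotProduct, mul_comm]

/-- A module over a polynomial ring generated by a family whose relations have no constant
terms needs at least as many generators as the size of the family. -/
theorem card_le_of_span_eq {k M ι : Type*} [Field k] [Fintype ι] [DecidableEq ι]
    [AddCommGroup M] [Module (Rk k) M] (g : ι → M)
    (hg : ∀ r : ι → Rk k, ∑ i, r i • g i = 0 → ∀ i, eval 0 (r i) = 0) (S : Finset M)
    (hS : Submodule.span (Rk k) (S : Set M) = Submodule.span (Rk k) (Set.range g)) :
    Fintype.card ι ≤ S.card := by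
  have h1 : ∀ i, ∃ c : S → Rk k, ∑ s, c s • (s : M) = g i := by
    intro i
    have : g i ∈ Submodule.span (Rk k) (Set.range ((↑) : S → M)) := by
      rw [Subtype.range_coe_subtype]
      change g i ∈ Submodule.span (Rk k) (S : Set M)
      rw [hS]
      exact Submodule.subset_span ⟨i, rfl⟩
    exact (Submodule.mem_span_range_iff_exists_fun _).1 this
  have h2 : ∀ s : S, ∃ d : ι → Rk k, ∑ i, d i • g i = s := by
    intro s
    have : (s : M) ∈ Submodule.span (Rk k) (Set.range g) := by
      rw [← hS]
      exact Submodule.subset_span s.2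
    exact (Submodule.mem_span_range_iff_exists_fun _).1 this
  choose c hc using h1
  choose d hd using h2
  have hCD : (Matrix.of fun i s => eval 0 (c i s)) * (Matrix.of fun s j => eval 0 (d s j))
      = (1 : Matrix ι ι k) := by
    ext i j
    have hrel := hg (fun j => ∑ s, c i s * d s j - (1 : Matrix ι ι (Rk k)) i j) (by
      simp only [sub_smul, Finset.sum_sub_distrib, Finset.sum_smul, mul_smul]
      rw [Finset.sum_comm]
      simp only [← Finset.smul_sum, hd, hc]
      simp [Matrix.one_apply]) j
    rw [map_sub, sub_eq_zero, map_sum] at hrel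
    simp only [map_mul] at hrel
    rw [Matrix.mul_apply]
    simp only [Matrix.of_apply]
    rw [hrel, Matrix.one_apply, Matrix.one_apply]
    split_ifs <;> simp
  have hr := Matrix.rank_mul_le_left (Matrix.of fun i s => eval 0 (c i s))
    (Matrix.of fun s j => eval 0 (d s j))
  rw [hCD, Matrix.rank_one] at hr
  simpa using hr.trans (Matrix.rank_le_card_width _)

/-- Restriction of polynomials to `z = w = 0`. -/
def restrictXY {k : Type*} [Field k] : Rk k →ₐ[k] Rk k :=
  aeval ![X 0, X 1, 0, 0]

theorem restrictXY_binForm {k : Type*} [Field k] (e : Fin 3 → k) :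
    restrictXY (binForm e) = binForm e := by
  simp [restrictXY, binForm]

theorem eval_zero_restrictXY {k : Type*} [Field k] (P : Rk k) :
    eval 0 (restrictXY P) = eval 0 P := by
  have : (eval (0 : Fin 4 → k)).comp (restrictXY (k := k)).toRingHom = eval 0 := by
    apply MvPolynomial.ringHom_ext
    · simp [restrictXY]
    · intro i
      fin_cases i <;> simp [restrictXY]
  exact congrArg (fun f => f P) this

theorem pderiv_binForm {k : Type*} [Field k] (e : Fin 3 → k) {i : Fin 4} (h0 : i ≠ 0)
    (h1 : i ≠ 1) : pderiv i (binForm e) = 0 := by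
  simp [binForm, Derivation.leibniz, Derivation.leibniz_pow, pderiv_X, h0.symm, h1.symm]

/-- The relations among the five generators of the syzygies of `z a, z b + w a, w b` have no
constant terms. -/
theorem eval_zero_of_relation {k : Type*} [Field k] {a b : Fin 3 → k} (ha : binForm a ≠ 0)
    (hb : binForm b ≠ 0) {r₁ r₂ r₃ r₄ r₅ : Rk k}
    (h : r₁ * binForm b ^ 2 + r₂ * (X 2 * binForm b + X 3 * binForm a)
      + r₃ * (X 3 * binForm b) + r₅ * X 3 ^ 2 = 0)
    (h' : r₁ * binForm a ^ 2 - r₃ * (X 2 * binForm a)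
      - r₄ * (X 2 * binForm b + X 3 * binForm a) + r₅ * X 2 ^ 2 = 0) :
    eval 0 r₁ = 0 ∧ eval 0 r₂ = 0 ∧ eval 0 r₃ = 0 ∧ eval 0 r₄ = 0 ∧ eval 0 r₅ = 0 := by
  have hz : restrictXY (X 2 : Rk k) = 0 := by simp [restrictXY]
  have hw : restrictXY (X 3 : Rk k) = 0 := by simp [restrictXY]
  have ea : eval 0 (binForm a) = 0 := by simp [binForm]
  have eb : eval 0 (binForm b) = 0 := by simp [binForm]
  have pa : ∀ i : Fin 4, i ≠ 0 → i ≠ 1 → pderiv i (binForm a) = 0 := fun i => pderiv_binForm a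
  have pb : ∀ i : Fin 4, i ≠ 0 → i ≠ 1 → pderiv i (binForm b) = 0 := fun i => pderiv_binForm b
  have pa2 := pa 2 (by decide) (by decide)
  have pa3 := pa 3 (by decide) (by decide)
  have pb2 := pb 2 (by decide) (by decide)
  have pb3 := pb 3 (by decide) (by decide)
  have d2 := congrArg (fun P => restrictXY (pderiv 2 P)) h
  have d3 := congrArg (fun P => restrictXY (pderiv 3 P)) h
  have d3' := congrArg (fun P => restrictXY (pderiv 3 P)) h'
  have d0 := congrArg restrictXY h
  simp [Derivation.leibniz, Derivation.leibniz_pow, pderiv_X, pa2, pa3, pb2, pb3, hz, hw,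
    restrictXY_binForm] at d0 d2 d3 d3'
  have e1 : restrictXY r₁ = 0 := by simpa [hb] using d0
  have e2 : restrictXY r₂ + binForm b * restrictXY (pderiv 2 r₁) = 0 := by
    apply mul_left_cancel₀ hb
    linear_combination d2
  have e3 : restrictXY r₃ + binForm b * restrictXY (pderiv 3 r₁)
      - binForm a * restrictXY (pderiv 2 r₁) = 0 := by
    apply mul_left_cancel₀ hb
    linear_combination d3 - binForm a * e2
  have e4 : restrictXY r₄ - binForm a * restrictXY (pderiv 3 r₁) = 0 := by
    apply mul_left_cancel₀ ha
    linear_combination -d3'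
  have e5 : (aeval ![0, 0, X 2, X 3] r₅ : Rk k) = 0 := by
    have := congrArg (aeval (![0, 0, X 2, X 3] : Fin 4 → Rk k)) h
    simpa [binForm] using this
  refine ⟨?_, ?_, ?_, ?_, ?_⟩
  · rw [← eval_zero_restrictXY, e1, map_zero]
  · have := congrArg (eval 0) e2
    simpa only [map_add, map_sub, map_mul, ea, eb, eval_zero_restrictXY, zero_mul, add_zero,
      sub_zero, map_zero] using this
  · have := congrArg (eval 0) e3
    simpa only [map_add, map_sub, map_mul, ea, eb, eval_zero_restrictXY, zero_mul, add_zero,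
      sub_zero, map_zero] using this
  · have := congrArg (eval 0) e4
    simpa only [map_add, map_sub, map_mul, ea, eb, eval_zero_restrictXY, zero_mul, add_zero,
      sub_zero, map_zero] using this
  · have hc : (eval (0 : Fin 4 → k)).comp
        (aeval (![0, 0, X 2, X 3] : Fin 4 → Rk k)).toRingHom = eval 0 := by
      apply MvPolynomial.ringHom_ext
      · simp
      · intro i
        fin_cases i <;> simp
    have := congrArg (fun f => f r₅) hc
    simp only [RingHom.comp_apply, AlgHom.toRingHom_eq_coe, RingHom.coe_coe, e5, map_zero] at this
    exact this.symm

theorem mem_Syz_iff {k : Type*} [Field k] (p v : Fin 3 → Rk k) :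
    v ∈ Syz p ↔ v ⬝ᵥ p = 0 := by
  simp [Syz, dotProduct, Fin.sum_univ_three]

theorem mem_SyzPiece_of {k : Type*} [Field k] {p v : Fin 3 → Rk k} {m n : ℤ}
    (h : ∀ i, Bihom (v i) (m - 2) (n - 1)) (hv : v ⬝ᵥ p = 0) : v ∈ SyzPiece p m n := by
  refine ⟨?_, ?_⟩
  · intro i _
    exact h i
  · simpa [syzMapk, dotProduct, Fin.sum_univ_three] using hv

theorem Bihom.mul {k : Type*} [Field k] {p q : Rk k} {m n m' n' : ℤ} (hp : Bihom p m n)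
    (hq : Bihom q m' n') : Bihom (p * q) (m + m') (n + n') :=
  IsWeightedHomogeneous.mul hp hq

theorem Bihom.add {k : Type*} [Field k] {p q : Rk k} {m n : ℤ} (hp : Bihom p m n)
    (hq : Bihom q m n) : Bihom (p + q) m n :=
  IsWeightedHomogeneous.add hp hq

theorem Bihom.neg {k : Type*} [Field k] {p : Rk k} {m n : ℤ} (hp : Bihom p m n) :
    Bihom (-p) m n :=
  (weightedHomogeneousSubmodule k bidegWt (m, n)).neg_mem hp

theorem bihom_zero {k : Type*} [Field k] (m n : ℤ) : Bihom (0 : Rk k) m n :=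
  isWeightedHomogeneous_zero _ _ _

theorem bihom_C {k : Type*} [Field k] (c : k) : Bihom (C c) 0 0 :=
  isWeightedHomogeneous_C _ _

theorem bihom_binForm {k : Type*} [Field k] (e : Fin 3 → k) : Bihom (binForm e) 2 0 := by
  have h0 : Bihom (X 0 : Rk k) 1 0 := isWeightedHomogeneous_X k bidegWt 0
  have h1 : Bihom (X 1 : Rk k) 1 0 := isWeightedHomogeneous_X k bidegWt 1
  rw [binForm, pow_two, pow_two]
  exact (((bihom_C _).mul (h0.mul h0)).add ((bihom_C _).mul (h0.mul h1))).add
    ((bihom_C _).mul (h1.mul h1))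

theorem bihom_vecMul {k : Type*} [Field k] {v : Fin 3 → Rk k} {m n : ℤ}
    (hv : ∀ i, Bihom (v i) m n) (Λ : Matrix (Fin 3) (Fin 3) k) (j : Fin 3) :
    Bihom (Matrix.vecMul v (Λ.map C) j) m n := by
  have h : ∀ i, Bihom (v i * C (Λ i j)) m n := fun i => by
    simpa using (hv i).mul (bihom_C (Λ i j))
  simp only [Matrix.vecMul, dotProduct, Fin.sum_univ_three, Matrix.map_apply]
  exact ((h 0).add (h 1)).add (h 2)

theorem cross_mem_KoszulSub {k : Type*} [Field k] (p0 p1 p2 : Rk k) (l l' : Fin 3 → Rk k) :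
    (l ⬝ᵥ ![p0, p1, p2]) • l' - (l' ⬝ᵥ ![p0, p1, p2]) • l ∈ KoszulSub p0 p1 p2 := by
  rw [KoszulSub, Submodule.mem_span_triple]
  refine ⟨l 1 * l' 0 - l' 1 * l 0, l 2 * l' 0 - l' 2 * l 0, l 2 * l' 1 - l' 2 * l 1, ?_⟩
  funext j
  fin_cases j <;> simp [dotProduct, Fin.sum_univ_three] <;> ring

/-- The five generators of the syzygies of `z a, z b + w a, w b`. -/
def normalGens {k : Type*} [Field k] (a b : Rk k) : Fin 5 → Fin 3 → Rk k :=
  ![![b ^ 2, -(a * b), a ^ 2], ![X 2 * b + X 3 * a, -(X 2 * a), 0], ![X 3 * b, 0, -(X 2 * a)],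
    ![0, X 3 * b, -(X 2 * b + X 3 * a)], ![X 3 ^ 2, -(X 2 * X 3), X 2 ^ 2]]

theorem exists_eq_sum_normalGens {k : Type*} [Field k] {a b : Rk k} (ha : a ≠ 0)
    (hab : IsRelPrime a b) (hai : ∀ i : Fin 4, i ≠ 0 → i ≠ 1 → killVar i a = a)
    (hbi : ∀ i : Fin 4, i ≠ 0 → i ≠ 1 → killVar i b = b) {v : Fin 3 → Rk k}
    (h : v ⬝ᵥ ![X 2 * a, X 2 * b + X 3 * a, X 3 * b] = 0) :
    ∃ r : Fin 5 → Rk k, v = ∑ i, r i • normalGens a b i := by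
  obtain ⟨r₁, r₂, r₃, r₄, r₅, h0, h1, h2⟩ := normal_form_syzygy (A := v 0) (B := v 1) (D := v 2)
    ha hab hai hbi (by simpa [dotProduct, Fin.sum_univ_three] using h)
  refine ⟨![r₁, r₂, r₃, r₄, r₅], ?_⟩
  funext j
  fin_cases j
  · simp [normalGens, Fin.sum_univ_five, h0]
  · simp [normalGens, Fin.sum_univ_five, h1]
    ring
  · simp [normalGens, Fin.sum_univ_five, h2]
    ring

theorem normalGens_dotProduct {k : Type*} [Field k] (a b : Rk k) (i : Fin 5) :
    normalGens a b i ⬝ᵥ ![X 2 * a, X 2 * b + X 3 * a, X 3 * b] = 0 := by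
  fin_cases i <;> simp [normalGens, dotProduct, Fin.sum_univ_three] <;> ring

theorem eval_zero_of_normalGens_relation {k : Type*} [Field k] {a b : Fin 3 → k}
    (ha : binForm a ≠ 0) (hb : binForm b ≠ 0) {r : Fin 5 → Rk k}
    (h : ∑ i, r i • normalGens (binForm a) (binForm b) i = 0) (i : Fin 5) : eval 0 (r i) = 0 := by
  have e0 := congrFun h 0
  have e2 := congrFun h 2
  simp [normalGens, Fin.sum_univ_five] at e0 e2
  obtain ⟨h1, h2, h3, h4, h5⟩ := eval_zero_of_relation (r₁ := r 0) (r₂ := r 1) (r₃ := r 2)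
    (r₄ := r 3) (r₅ := r 4) ha hb e0 (by linear_combination e2)
  fin_cases i <;> assumption

/-- A non-generic triple without common zeros becomes `z a, z b + w a, w b` after a linear change
of basis. -/
theorem exists_change_of_basis {k : Type*} [Field k] [IsAlgClosed k] {p0 p1 p2 : Rk k}
    (h0 : Bihom p0 2 1) (h1 : Bihom p1 2 1) (h2 : Bihom p2 2 1)
    (hncz : NoCommonZeros p0 p1 p2) (hgen : ¬ BidegGeneric p0 p1 p2) :
    ∃ (Λ : Matrix (Fin 3) (Fin 3) k) (a b : Fin 3 → k), IsUnit Λ.det ∧ binForm a ≠ 0 ∧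
      binForm b ≠ 0 ∧ IsRelPrime (binForm a) (binForm b) ∧
      Matrix.mulVec (Λ.map C) ![p0, p1, p2] =
        ![X 2 * binForm a, X 2 * binForm b + X 3 * binForm a, X 3 * binForm b] := by
  obtain ⟨F, G, H, hdet, hp⟩ : ∃ F G : Fin 3 → Fin 3 → k, NoZero F G ∧
      (∀ t : k, Matrix.det (Matrix.of fun i j => F i j + t * G i j) = 0) ∧
      ∀ i, (![p0, p1, p2] : Fin 3 → Rk k) i = X 2 * binForm (F i) + X 3 * binForm (G i) := by
    obtain ⟨F0, G0, rfl⟩ := h0.eq_two_one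
    obtain ⟨F1, G1, rfl⟩ := h1.eq_two_one
    obtain ⟨F2, G2, rfl⟩ := h2.eq_two_one
    have H : NoZero ![F0, F1, F2] ![G0, G1, G2] := by
      intro x y c d hxy hcd
      have h := hncz x y c d hxy hcd
      simp only [map_add, map_mul, eval_X, eval_binForm] at h
      rcases h with h | h | h
      · exact ⟨0, h⟩
      · exact ⟨1, h⟩
      · exact ⟨2, h⟩
    exact ⟨_, _, H, H.singular_pencil hgen, fun i => by fin_cases i <;> rfl⟩
  obtain ⟨Λ, a, b, hΛ, hab, r1, r2, r3, r4, r5, r6⟩ := H.exists_normal_form (by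
    intro t
    rw [← hdet t, Matrix.det_fin_three]
    simp [cross_apply, Fin.sum_univ_three]
    ring)
  obtain ⟨x, y, hxy, hbz⟩ := exists_quadVal_zero b
  obtain ⟨x', y', hxy', haz⟩ := exists_quadVal_zero a
  refine ⟨Λ, a, b, isUnit_iff_ne_zero.2 hΛ,
    binForm_ne_zero_of_eval ((hab x y hxy).resolve_right (by simp [hbz])),
    binForm_ne_zero_of_eval ((hab x' y' hxy').resolve_left (by simp [haz])),
    isRelPrime_binForm hab, ?_⟩
  have combo : ∀ (v e e' : Fin 3 → k), (∀ j, ∑ i, v i * F i j = e j) →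
      (∀ j, ∑ i, v i * G i j = e' j) →
      (fun i => (C (v i) : Rk k)) ⬝ᵥ ![p0, p1, p2] = X 2 * binForm e + X 3 * binForm e' := by
    intro v e e' hF hG
    simp only [dotProduct, Fin.sum_univ_three, hp, binForm, ← hF, ← hG, map_add, map_mul]
    ring
  have z0 : binForm (0 : Fin 3 → k) = 0 := by simp [binForm]
  funext i
  fin_cases i
  · have := combo (Λ 0) a 0 r1 r2
    rwa [z0, mul_zero, add_zero] at this
  · exact combo (Λ 1) b a r3 r4
  · have := combo (Λ 2) 0 b r5 r6
    rwa [z0, mul_zero, zero_add] at this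

/-- The syzygies obtained from `normalGens` by the change of basis `Λ`. -/
def changedGens {k : Type*} [Field k] (Λ : Matrix (Fin 3) (Fin 3) k) (a b : Rk k) (i : Fin 5) :
    Fin 3 → Rk k :=
  Matrix.vecMul (normalGens a b i) (Λ.map C)

theorem sum_changedGens {k : Type*} [Field k] (Λ : Matrix (Fin 3) (Fin 3) k) (a b : Rk k)
    (r : Fin 5 → Rk k) :
    ∑ i, r i • changedGens Λ a b i = Matrix.vecMul (∑ i, r i • normalGens a b i) (Λ.map C) := by
  simp only [changedGens, Matrix.sum_vecMul, Matrix.smul_vecMul]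

theorem changedGens_dotProduct {k : Type*} [Field k] {Λ : Matrix (Fin 3) (Fin 3) k} {a b : Rk k}
    {p : Fin 3 → Rk k}
    (hq : Matrix.mulVec (Λ.map C) p = ![X 2 * a, X 2 * b + X 3 * a, X 3 * b]) (i : Fin 5) :
    changedGens Λ a b i ⬝ᵥ p = 0 := by
  rw [changedGens, ← Matrix.dotProduct_mulVec, hq, normalGens_dotProduct]

theorem map_C_nonsing_inv_mul {k : Type*} [Field k] {Λ : Matrix (Fin 3) (Fin 3) k}
    (hΛ : IsUnit Λ.det) : (Λ⁻¹.map C * Λ.map C : Matrix (Fin 3) (Fin 3) (Rk k)) = 1 := by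
  rw [← Matrix.map_mul, Matrix.nonsing_inv_mul _ hΛ]
  exact Matrix.map_one _ C.map_zero C.map_one

theorem map_C_mul_nonsing_inv {k : Type*} [Field k] {Λ : Matrix (Fin 3) (Fin 3) k}
    (hΛ : IsUnit Λ.det) : (Λ.map C * Λ⁻¹.map C : Matrix (Fin 3) (Fin 3) (Rk k)) = 1 := by
  rw [← Matrix.map_mul, Matrix.mul_nonsing_inv _ hΛ]
  exact Matrix.map_one _ C.map_zero C.map_one

theorem span_changedGens {k : Type*} [Field k] {Λ : Matrix (Fin 3) (Fin 3) k} {a b : Fin 3 → k}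
    {p : Fin 3 → Rk k} (hΛ : IsUnit Λ.det) (ha : binForm a ≠ 0)
    (hab : IsRelPrime (binForm a) (binForm b))
    (hq : Matrix.mulVec (Λ.map C) p =
      ![X 2 * binForm a, X 2 * binForm b + X 3 * binForm a, X 3 * binForm b]) :
    Submodule.span (Rk k) (Set.range (changedGens Λ (binForm a) (binForm b))) = Syz p := by
  apply le_antisymm
  · rw [Submodule.span_le]
    rintro _ ⟨i, rfl⟩
    exact (mem_Syz_iff _ _).2 (changedGens_dotProduct hq i)
  · intro v hv
    rw [mem_Syz_iff] at hv
    obtain ⟨r, hr⟩ := exists_eq_sum_normalGens (v := Matrix.vecMul v (Λ⁻¹.map C)) ha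
      hab (fun i => killVar_binForm a) (fun i => killVar_binForm b) (by
        rw [← hq, Matrix.dotProduct_mulVec, Matrix.vecMul_vecMul, map_C_nonsing_inv_mul hΛ,
          Matrix.vecMul_one, hv])
    refine (Submodule.mem_span_range_iff_exists_fun _).2 ⟨r, ?_⟩
    rw [sum_changedGens, ← hr, Matrix.vecMul_vecMul, map_C_nonsing_inv_mul hΛ, Matrix.vecMul_one]

theorem eval_zero_of_changedGens_relation {k : Type*} [Field k] {Λ : Matrix (Fin 3) (Fin 3) k}
    {a b : Fin 3 → k} (hΛ : IsUnit Λ.det) (ha : binForm a ≠ 0) (hb : binForm b ≠ 0)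
    {r : Fin 5 → Rk k} (h : ∑ i, r i • changedGens Λ (binForm a) (binForm b) i = 0)
    (i : Fin 5) : eval 0 (r i) = 0 := by
  apply eval_zero_of_normalGens_relation ha hb
  rw [sum_changedGens] at h
  have h' := congrArg (fun v => Matrix.vecMul v (Λ⁻¹.map C)) h
  simpa only [Matrix.vecMul_vecMul, map_C_mul_nonsing_inv hΛ, Matrix.vecMul_one,
    Matrix.zero_vecMul] using h'

/-- The middle three generators come from Koszul syzygies. -/
theorem changedGens_mem_KoszulSub {k : Type*} [Field k] {Λ : Matrix (Fin 3) (Fin 3) k}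
    {a b p0 p1 p2 : Rk k}
    (hq : Matrix.mulVec (Λ.map C) ![p0, p1, p2] = ![X 2 * a, X 2 * b + X 3 * a, X 3 * b])
    {i : Fin 5} (h0 : i ≠ 0) (h4 : i ≠ 4) : changedGens Λ a b i ∈ KoszulSub p0 p1 p2 := by
  have q0 : Λ.map C 0 ⬝ᵥ ![p0, p1, p2] = X 2 * a := congrFun hq 0
  have q1 : Λ.map C 1 ⬝ᵥ ![p0, p1, p2] = X 2 * b + X 3 * a := congrFun hq 1
  have q2 : Λ.map C 2 ⬝ᵥ ![p0, p1, p2] = X 3 * b := congrFun hq 2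
  have c1 := cross_mem_KoszulSub p0 p1 p2 (Λ.map C 1) (Λ.map C 0)
  have c2 := cross_mem_KoszulSub p0 p1 p2 (Λ.map C 2) (Λ.map C 0)
  have c3 := cross_mem_KoszulSub p0 p1 p2 (Λ.map C 2) (Λ.map C 1)
  rw [q1, q0] at c1
  rw [q2, q0] at c2
  rw [q2, q1] at c3
  fin_cases i
  · exact absurd rfl h0
  · convert c1 using 1
    funext j
    simp [changedGens, normalGens, Matrix.vecMul, dotProduct, Fin.sum_univ_three]
    ring
  · convert c2 using 1
    funext j
    simp [changedGens, normalGens, Matrix.vecMul, dotProduct, Fin.sum_univ_three]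
    ring
  · convert c3 using 1
    funext j
    simp [changedGens, normalGens, Matrix.vecMul, dotProduct, Fin.sum_univ_three]
    ring
  · exact absurd rfl h4

/-- In the non-generic case, `Syz(p)` has five minimal generators: one of
bidegree `(6,1)`, the three Koszul syzygies of bidegree `(4,2)`, and one of bidegree `(2,3)`. -/
theorem statement8 {k : Type*} [Field k] [IsAlgClosed k] (p0 p1 p2 : Rk k)
    (h0 : Bihom p0 2 1) (h1 : Bihom p1 2 1) (h2 : Bihom p2 2 1)
    (hncz : NoCommonZeros p0 p1 p2) (hgen : ¬ BidegGeneric p0 p1 p2) :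
    (∃ s u : Fin 3 → Rk k,
      s ∈ SyzPiece ![p0, p1, p2] 6 1 ∧
      u ∈ SyzPiece ![p0, p1, p2] 2 3 ∧
      (![p1, -p0, 0] : Fin 3 → Rk k) ∈ SyzPiece ![p0, p1, p2] 4 2 ∧
      (![p2, 0, -p0] : Fin 3 → Rk k) ∈ SyzPiece ![p0, p1, p2] 4 2 ∧
      (![0, p2, -p1] : Fin 3 → Rk k) ∈ SyzPiece ![p0, p1, p2] 4 2 ∧
      Submodule.span (Rk k)
          {s, ![p1, -p0, 0], ![p2, 0, -p0], ![0, p2, -p1], u}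
        = Syz ![p0, p1, p2]) ∧
    ∀ S : Finset (Fin 3 → Rk k),
      Submodule.span (Rk k) (S : Set (Fin 3 → Rk k)) = Syz ![p0, p1, p2] → 5 ≤ S.card := by
  obtain ⟨Λ, a, b, hΛ, ha, hb, hab, hq⟩ := exists_change_of_basis h0 h1 h2 hncz hgen
  have hspan := span_changedGens hΛ ha hab hq
  have hgp := changedGens_dotProduct hq
  have hz : Bihom (X 2 : Rk k) 0 1 := isWeightedHomogeneous_X k bidegWt 2
  have hw : Bihom (X 3 : Rk k) 0 1 := isWeightedHomogeneous_X k bidegWt 3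
  have hA := bihom_binForm a
  have hB := bihom_binForm b
  have k1 : (![p1, -p0, 0] : Fin 3 → Rk k) ⬝ᵥ ![p0, p1, p2] = 0 := by
    simp [dotProduct, Fin.sum_univ_three]
    ring
  have k2 : (![p2, 0, -p0] : Fin 3 → Rk k) ⬝ᵥ ![p0, p1, p2] = 0 := by
    simp [dotProduct, Fin.sum_univ_three]
    ring
  have k3 : (![0, p2, -p1] : Fin 3 → Rk k) ⬝ᵥ ![p0, p1, p2] = 0 := by
    simp [dotProduct, Fin.sum_univ_three]
    ring
  refine ⟨⟨changedGens Λ (binForm a) (binForm b) 0, changedGens Λ (binForm a) (binForm b) 4,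
    ?_, ?_, ?_, ?_, ?_, ?_⟩, ?_⟩
  · refine mem_SyzPiece_of (bihom_vecMul ?_ Λ) (hgp 0)
    intro i
    fin_cases i
    · simpa [normalGens, pow_two] using hB.mul hB
    · simpa [normalGens] using (hA.mul hB).neg
    · simpa [normalGens, pow_two] using hA.mul hA
  · refine mem_SyzPiece_of (bihom_vecMul ?_ Λ) (hgp 4)
    intro i
    fin_cases i
    · simpa [normalGens, pow_two] using hw.mul hw
    · simpa [normalGens] using (hz.mul hw).neg
    · simpa [normalGens, pow_two] using hz.mul hz
  · refine mem_SyzPiece_of (fun i => ?_) k1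
    fin_cases i
    exacts [h1, h0.neg, bihom_zero _ _]
  · refine mem_SyzPiece_of (fun i => ?_) k2
    fin_cases i
    exacts [h2, bihom_zero _ _, h0.neg]
  · refine mem_SyzPiece_of (fun i => ?_) k3
    fin_cases i
    exacts [bihom_zero _ _, h2, h1.neg]
  · apply le_antisymm
    · rw [Submodule.span_le]
      rintro _ (rfl | rfl | rfl | rfl | rfl)
      exacts [(mem_Syz_iff _ _).2 (hgp 0), (mem_Syz_iff _ _).2 k1, (mem_Syz_iff _ _).2 k2,
        (mem_Syz_iff _ _).2 k3, (mem_Syz_iff _ _).2 (hgp 4)]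
    · rw [← hspan, Submodule.span_le]
      rintro _ ⟨i, rfl⟩
      by_cases hi0 : i = 0
      · subst hi0
        exact Submodule.subset_span (by simp)
      by_cases hi4 : i = 4
      · subst hi4
        exact Submodule.subset_span (by simp)
      refine Submodule.span_mono ?_ (changedGens_mem_KoszulSub hq hi0 hi4)
      intro v hv
      simp only [Set.mem_insert_iff, Set.mem_singleton_iff] at hv ⊢
      tauto
  · intro S hS
    simpa using card_le_of_span_eq _
      (fun r hr => eval_zero_of_changedGens_relation hΛ ha hb hr) S (hS.trans hspan.symm)
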